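/- arXiv:2510.08751 — 2 statements merged into one kernel-verified Lean document; each statement's English description precedes it below -/
import Mathlib

section
/- Assume det A > 0, tr A = 0 (so A has a pair of pure imaginary eigenvalues), ω(Aζ, ζ) ≠ 0, and α·det A + ω(Aζ, θη) = 0 (so the ad-rank condition fails). Let C₂ ⊆ ℝ² be a control set of the planar linear control system v̇ = Av + uζ, u(t) ∈ Ω (with the same notion of admissible controls and control sets) such that 0 ∈ interior(C₂). Then the cylinder C₂ × ℝ is a control set of Σ_ℍ, and it is the only control set of Σ_ℍ. -/
open Set Matrix

noncomputable section

/-- Vectors in the plane. -/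
abbrev V2 := Fin 2 → ℝ

/-- The standard symplectic form on `ℝ²`: `ω(v,w) = v₁w₂ − v₂w₁`. -/
def omega2 (v w : V2) : ℝ := v 0 * w 1 - v 1 * w 0

/-- Counterclockwise rotation by `π/2`. -/
def theta (v : V2) : V2 := ![-(v 1), v 0]

/-- `u` is piecewise constant on `[0,∞)`: on every interval `[0,T]` it is a finite
step function (right-continuous convention). -/
def PiecewiseConst (u : ℝ → ℝ) : Prop :=
  ∀ T : ℝ, 0 ≤ T → ∃ (n : ℕ) (τ : ℕ → ℝ), τ 0 = 0 ∧ StrictMono τ ∧ T ≤ τ n ∧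
    ∀ i < n, ∀ s ∈ Ico (τ i) (τ (i + 1)), u s = u (τ i)

/-- Admissible controls: piecewise constant functions with values in `Ω`. -/
def Admissible (Ω : Set ℝ) (u : ℝ → ℝ) : Prop :=
  (∀ t, u t ∈ Ω) ∧ PiecewiseConst u

/-- `x` is a trajectory of the control system `ẋ = f(u(t), x)` on `[0,∞)`
with control `u`. -/
def IsTraj {M : Type*} [NormedAddCommGroup M] [NormedSpace ℝ M]
    (f : ℝ → M → M) (u : ℝ → ℝ) (x : ℝ → M) : Prop :=
  ContinuousOn x (Ici 0) ∧
    ∀ t ∈ Ici (0 : ℝ), HasDerivWithinAt x (f (u t) (x t)) (Ici t) t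

/-- The positive orbit `O⁺(p)` of the control system `f` with control range `Ω`. -/
def PosOrbit {M : Type*} [NormedAddCommGroup M] [NormedSpace ℝ M]
    (f : ℝ → M → M) (Ω : Set ℝ) (p : M) : Set M :=
  {q | ∃ (u : ℝ → ℝ) (x : ℝ → M) (T : ℝ), Admissible Ω u ∧ IsTraj f u x ∧
    x 0 = p ∧ 0 ≤ T ∧ x T = q}

/-- The two defining properties of a control set: (i) for every `p ∈ C` there is an
admissible control keeping the trajectory in `C` for all positive times;
(ii) `C ⊆ cl O⁺(p)` for all `p ∈ C`.  (Nonemptiness is also required.) -/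
def ControlSetProp {M : Type*} [NormedAddCommGroup M] [NormedSpace ℝ M]
    (f : ℝ → M → M) (Ω : Set ℝ) (C : Set M) : Prop :=
  C.Nonempty ∧
  (∀ p ∈ C, ∃ (u : ℝ → ℝ) (x : ℝ → M), Admissible Ω u ∧ IsTraj f u x ∧ x 0 = p ∧
      ∀ t : ℝ, 0 ≤ t → x t ∈ C) ∧
  (∀ p ∈ C, C ⊆ closure (PosOrbit f Ω p))

/-- A control set: a set satisfying `ControlSetProp`, maximal w.r.t. set inclusion
among such sets. -/
def IsControlSet {M : Type*} [NormedAddCommGroup M] [NormedSpace ℝ M]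
    (f : ℝ → M → M) (Ω : Set ℝ) (C : Set M) : Prop :=
  ControlSetProp f Ω C ∧ ∀ C', ControlSetProp f Ω C' → C ⊆ C' → C = C'

/-- The right-hand side of the linear control system `Σ_ℍ` on the Heisenberg group
`ℍ = ℝ² × ℝ`:  `v̇ = Av + uζ`, `ż = (tr A) z + uα + ω(v, θη + (u/2)ζ)`. -/
def heisF (A : Matrix (Fin 2) (Fin 2) ℝ) (η ζ : V2) (α : ℝ) (u : ℝ)
    (p : V2 × ℝ) : V2 × ℝ :=
  (A.mulVec p.1 + u • ζ,
    A.trace * p.2 + u * α + omega2 p.1 (theta η + (u / 2) • ζ))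

/-- The right-hand side of the planar linear control system `v̇ = Av + uζ`. -/
def planF (A : Matrix (Fin 2) (Fin 2) ℝ) (ζ : V2) (u : ℝ) (v : V2) : V2 :=
  A.mulVec v + u • ζ

/-- The derivation `𝒟(v,z) = (Av, ω(v,θη) + (tr A) z)` of the Heisenberg Lie
algebra associated to the drift of `Σ_ℍ`. -/
def Dmap (A : Matrix (Fin 2) (Fin 2) ℝ) (η : V2) (p : V2 × ℝ) : V2 × ℝ :=
  (A.mulVec p.1, omega2 p.1 (theta η) + A.trace * p.2)

theorem PiecewiseConst.prepend {u : ℝ → ℝ} (hu : PiecewiseConst u) (c : ℝ) {r : ℝ} (hr : 0 < r) :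
    PiecewiseConst (fun t => if t < r then c else u (t - r)) := by
  intro T hT
  obtain ⟨n, τ, h0, hmono, hTn, hconst⟩ := hu T hT
  have hpos : ∀ i, 0 ≤ τ i := fun i => h0 ▸ hmono.monotone (Nat.zero_le i)
  refine ⟨n + 1, fun i => Nat.casesOn i 0 (fun j => r + τ j), rfl, ?_, ?_, ?_⟩
  · refine strictMono_nat_of_lt_succ fun i => ?_
    cases i with
    | zero => simpa [h0] using hr
    | succ j => simpa using hmono (Nat.lt_succ_self j)
  · change T ≤ r + τ n
    linarith
  · intro i hi t ht
    cases i with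
    | zero =>
      have h2 : t < r := by simpa [h0] using ht.2
      simp [h2, hr]
    | succ j =>
      have h1 : r + τ j ≤ t := ht.1
      have h2 : t < r + τ (j + 1) := ht.2
      have h3 : ¬ t < r := by linarith [hpos j]
      have h4 : ¬ r + τ j < r := by linarith [hpos j]
      have := hconst j (by omega) (t - r) ⟨by linarith, by linarith⟩
      simp only [h3, h4, if_false, this]
      congr 1
      ring

section Orbits

variable {M : Type*} [NormedAddCommGroup M] [NormedSpace ℝ M] {f : ℝ → M → M} {Ω : Set ℝ}

theorem IsTraj.prepend {u : ℝ → ℝ} {x y : ℝ → M} {c r : ℝ} (hr : 0 < r) (hx : IsTraj f u x)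
    (hy : ∀ t, HasDerivAt y (f c (y t)) t) (hyx : y r = x 0) :
    IsTraj f (fun t => if t < r then c else u (t - r))
      (fun t => if t < r then y t else x (t - r)) := by
  have hyc : Continuous y := continuous_iff_continuousAt.2 fun t => (hy t).continuousAt
  constructor
  · have h1 : ContinuousOn (fun t => if t < r then y t else x (t - r)) (Iic r) :=
      hyc.continuousOn.congr fun t (ht : t ≤ r) => by
        rcases ht.lt_or_eq with h | rfl
        · simp [h]
        · simp [hyx]
    have h2 : ContinuousOn (fun t => if t < r then y t else x (t - r)) (Ici r) := by
      have h3 : ContinuousOn (fun t => x (t - r)) (Ici r) :=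
        hx.1.comp (by fun_prop) fun t (ht : r ≤ t) => by simpa using ht
      exact h3.congr fun t (ht : r ≤ t) => by simp [not_lt.2 ht]
    have h3 := h1.union_of_isClosed h2 isClosed_Iic isClosed_Ici
    rw [Iic_union_Ici] at h3
    exact h3.mono (subset_univ _)
  · intro t ht
    by_cases h : t < r
    · simp only [h, if_true]
      refine (hy t).hasDerivWithinAt.congr_of_eventuallyEq ?_ (by simp [h])
      filter_upwards [mem_nhdsWithin_of_mem_nhds (Iio_mem_nhds h)] with s hs
      simp [show s < r from hs]
    · simp only [h, if_false]
      have h' : r ≤ t := not_lt.1 h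
      have h1 := hx.2 (t - r) (by simpa using h')
      have h2 : HasDerivWithinAt (fun s => x (s - r)) (f (u (t - r)) (x (t - r))) (Ici t) t := by
        have h3 := h1.scomp t ((hasDerivAt_id t).sub_const r).hasDerivWithinAt
          (s := Ici t) fun s (hs : t ≤ s) => by simpa using hs
        simpa [Function.comp_def] using h3
      refine h2.congr (fun s (hs : t ≤ s) => ?_) (by simp [h])
      simp [not_lt.2 (h'.trans hs)]

theorem PosOrbit.of_constant_step {y : ℝ → M} {c r : ℝ} {q : M} (hc : c ∈ Ω) (hr : 0 ≤ r)
    (hy : ∀ t, HasDerivAt y (f c (y t)) t) (hq : q ∈ PosOrbit f Ω (y r)) :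
    q ∈ PosOrbit f Ω (y 0) := by
  rcases hr.eq_or_lt with rfl | hr
  · exact hq
  obtain ⟨u, x, T, hu, hx, hx0, hT, rfl⟩ := hq
  refine ⟨_, _, r + T, ⟨fun t => ?_, hu.2.prepend c hr⟩, hx.prepend hr hy hx0.symm, by simp [hr],
    by linarith, by simp [not_lt.2 hT]⟩
  split_ifs
  exacts [hc, hu.1 _]

theorem PosOrbit.self_mem {y : ℝ → M} {c : ℝ} (hc : c ∈ Ω)
    (hy : ∀ t, HasDerivAt y (f c (y t)) t) : y 0 ∈ PosOrbit f Ω (y 0) :=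
  ⟨fun _ => c, y, 0, ⟨fun _ => hc, fun T _ => ⟨⌈T⌉₊, fun n => n, by simp, Nat.strictMono_cast,
    Nat.le_ceil T, fun _ _ _ _ => rfl⟩⟩,
    ⟨(continuous_iff_continuousAt.2 fun t => (hy t).continuousAt).continuousOn,
      fun t _ => (hy t).hasDerivWithinAt⟩, rfl, le_rfl, rfl⟩

theorem controlSetProp_univ (h : ∀ p q, q ∈ PosOrbit f Ω p) : ControlSetProp f Ω univ := by
  refine ⟨⟨0, trivial⟩, fun p _ => ?_, fun p _ q _ => subset_closure (h p q)⟩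
  obtain ⟨u, x, -, hu, hx, hx0, -⟩ := h p p
  exact ⟨u, x, hu, hx, hx0, fun _ _ => trivial⟩

theorem IsControlSet.eq_univ (h : ControlSetProp f Ω univ) {C : Set M}
    (hC : IsControlSet f Ω C) : C = univ :=
  hC.2 univ h (subset_univ C)

end Orbits

/-- Time-`τ` flow of `x' = y`, `y' = -(x - w)`, `s' = w x` for constant `w`. -/
def oscFlow (w τ : ℝ) (p : ℝ × ℝ × ℝ) : ℝ × ℝ × ℝ :=
  (w + (p.1 - w) * Real.cos τ + p.2.1 * Real.sin τ,
    p.2.1 * Real.cos τ - (p.1 - w) * Real.sin τ,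
    p.2.2 + w * (w * τ + (p.1 - w) * Real.sin τ + p.2.1 * (1 - Real.cos τ)))

/-- Reachability by concatenations of `oscFlow` with controls in `[-ε, ε]`. -/
def OscReach (ε : ℝ) : ℝ × ℝ × ℝ → ℝ × ℝ × ℝ → Prop :=
  Relation.ReflTransGen fun p q => ∃ w τ, |w| ≤ ε ∧ 0 ≤ τ ∧ q = oscFlow w τ p

namespace OscReach

variable {ε : ℝ}

theorem flow {w τ : ℝ} (hw : |w| ≤ ε) (hτ : 0 ≤ τ) {p q : ℝ × ℝ × ℝ} (h : oscFlow w τ p = q) :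
    OscReach ε p q :=
  .single ⟨w, τ, hw, hτ, h.symm⟩

@[refl]
protected theorem rfl {p : ℝ × ℝ × ℝ} : OscReach ε p p :=
  Relation.ReflTransGen.refl

theorem trans {p q r : ℝ × ℝ × ℝ} (h₁ : OscReach ε p q) (h₂ : OscReach ε q r) : OscReach ε p r :=
  Relation.ReflTransGen.trans h₁ h₂

theorem reverse {p q : ℝ × ℝ × ℝ} (h : OscReach ε p q) :
    OscReach ε (q.1, -q.2.1, -q.2.2) (p.1, -p.2.1, -p.2.2) := by
  induction h with
  | refl => exact .refl
  | @tail b c _ hbc ih =>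
    obtain ⟨w, τ, hw, hτ, rfl⟩ := hbc
    refine trans (flow hw hτ ?_) ih
    have := Real.sin_sq_add_cos_sq τ
    simp only [oscFlow, Prod.mk.injEq]
    refine ⟨?_, ?_, ?_⟩
    · linear_combination (b.1 - w) * this
    · linear_combination (-b.2.1) * this
    · linear_combination (w * b.2.1) * this

theorem translate {p q : ℝ × ℝ × ℝ} (h : OscReach ε p q) (a : ℝ) :
    OscReach ε (p.1, p.2.1, p.2.2 + a) (q.1, q.2.1, q.2.2 + a) := by
  induction h with
  | refl => exact .refl
  | tail _ hbc ih =>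
    obtain ⟨w, τ, hw, hτ, rfl⟩ := hbc
    refine trans ih (flow hw hτ ?_)
    simp only [oscFlow, Prod.mk.injEq, true_and]
    ring

theorem two_half_turns {w : ℝ} (hw : |w| ≤ ε) (x s : ℝ) :
    OscReach ε (x, 0, s) (x - 4 * w, 0, s + 2 * Real.pi * w ^ 2) := by
  refine trans (flow hw Real.pi_pos.le rfl)
    (flow (w := -w) (by rwa [abs_neg]) Real.pi_pos.le ?_)
  simp only [oscFlow, Real.cos_pi, Real.sin_pi, Prod.mk.injEq]
  refine ⟨?_, ?_, ?_⟩ <;> ring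

theorem half_turns {w : ℝ} (hw : |w| ≤ ε) (x s : ℝ) (n : ℕ) :
    OscReach ε (x, 0, s) (x - n * (4 * w), 0, s + n * (2 * Real.pi * w ^ 2)) := by
  induction n with
  | zero => simpa using OscReach.rfl
  | succ n ih =>
    refine trans ih ?_
    convert two_half_turns hw _ _ using 2
    · push_cast
      ring
    · push_cast
      congr 1
      ring

theorem exists_to_origin (hε : 0 < ε) (x y s : ℝ) : ∃ s', OscReach ε (x, y, s) (0, 0, s') := by
  obtain ⟨r, θ, hθ, hx, hy⟩ : ∃ r θ, 0 ≤ θ ∧ x = r * Real.cos θ ∧ y = r * Real.sin θ := by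
    refine ⟨‖(⟨x, y⟩ : ℂ)‖, Complex.arg ⟨x, y⟩ + 2 * Real.pi, ?_, ?_, ?_⟩
    · linarith [Complex.neg_pi_lt_arg ⟨x, y⟩, Real.pi_pos]
    · rw [Real.cos_add_two_pi, Complex.norm_mul_cos_arg]
    · rw [Real.sin_add_two_pi, Complex.norm_mul_sin_arg]
  have h1 : OscReach ε (x, y, s) (r, 0, s) := by
    refine flow (w := 0) (by simpa using hε.le) hθ ?_
    have := Real.sin_sq_add_cos_sq θ
    simp only [oscFlow, hx, hy, Prod.mk.injEq]
    refine ⟨?_, ?_, ?_⟩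
    · linear_combination r * this
    · ring
    · ring
  obtain ⟨n, hn⟩ := exists_nat_ge (|r| / ε)
  have hn1 : (0 : ℝ) < n + 1 := by positivity
  have hw : |r / (4 * (n + 1))| ≤ ε := by
    rw [abs_div, abs_of_pos (by positivity : (0 : ℝ) < 4 * (n + 1)), div_le_iff₀ (by positivity)]
    rw [div_le_iff₀ hε] at hn
    nlinarith [mul_nonneg n.cast_nonneg hε.le]
  have h2 := half_turns hw r s (n + 1)
  have h3 : r - ((n + 1 : ℕ) : ℝ) * (4 * (r / (4 * (n + 1)))) = 0 := by
    push_cast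
    field_simp
    ring
  rw [h3] at h2
  exact ⟨_, h1.trans h2⟩

theorem exists_from_origin (hε : 0 < ε) (x y s : ℝ) : ∃ s', OscReach ε (0, 0, s') (x, y, s) := by
  obtain ⟨s', h⟩ := exists_to_origin hε x (-y) (-s)
  exact ⟨-s', by simpa using h.reverse⟩

theorem origin_raise (hε : 0 < ε) {s s' : ℝ} (h : s ≤ s') : OscReach ε (0, 0, s) (0, 0, s') := by
  obtain ⟨n, hn⟩ := exists_nat_ge (Real.sqrt ((s' - s) / (2 * Real.pi)) / ε)
  set r := Real.sqrt ((s' - s) / (2 * Real.pi))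
  have hr : r ^ 2 = (s' - s) / (2 * Real.pi) :=
    Real.sq_sqrt (div_nonneg (by linarith) (by positivity))
  have hr0 : 0 ≤ r := Real.sqrt_nonneg _
  have hn1 : (0 : ℝ) < n + 1 := by positivity
  have key : ∀ m : ℕ, ∀ w : ℝ, |w| ≤ ε →
      OscReach ε (0, 0, s) (0, 0, s + m * (2 * Real.pi * w ^ 2)) := by
    intro m w hw
    induction m with
    | zero => simpa using OscReach.rfl
    | succ m ih =>
      refine trans ih (flow hw (τ := 2 * Real.pi) (by positivity) ?_)
      simp only [oscFlow, Real.cos_two_pi, Real.sin_two_pi, Prod.mk.injEq]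
      refine ⟨?_, ?_, ?_⟩ <;> push_cast <;> ring
  have hw : |r / (n + 1)| ≤ ε := by
    rw [abs_of_nonneg (by positivity), div_le_iff₀ hn1]
    rw [div_le_iff₀ hε] at hn
    nlinarith
  convert key ((n + 1) ^ 2) _ hw using 3
  push_cast
  field_simp
  rw [hr]
  field_simp
  ring

theorem lowering_loop (hε : 0 < ε) (s : ℝ) (n : ℕ) :
    OscReach ε (0, ε, s) (0, ε, s - n * (ε ^ 2 * (4 - Real.pi))) := by
  induction n with
  | zero => simpa using OscReach.rfl
  | succ n ih =>
    refine trans ih (trans (flow (w := -ε) (by simp [abs_of_pos hε]) Real.pi_div_two_pos.le rfl)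
      (flow (w := ε) (by simp [abs_of_pos hε]) Real.pi_div_two_pos.le ?_))
    simp only [oscFlow, Real.cos_pi_div_two, Real.sin_pi_div_two, Prod.mk.injEq]
    refine ⟨?_, ?_, ?_⟩ <;> push_cast <;> ring

theorem origin_fiber (hε : 0 < ε) (s s' : ℝ) : OscReach ε (0, 0, s) (0, 0, s') := by
  obtain ⟨a, ha⟩ := exists_from_origin hε 0 ε 0
  obtain ⟨b, hb⟩ := exists_to_origin hε 0 ε 0
  have hδ : 0 < ε ^ 2 * (4 - Real.pi) :=
    mul_pos (by positivity) (by linarith [Real.pi_lt_four])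
  obtain ⟨n, hn⟩ := exists_nat_ge ((s - a + b - s') / (ε ^ 2 * (4 - Real.pi)))
  rw [div_le_iff₀ hδ] at hn
  have h1 := ha.translate (s - a)
  have h2 := lowering_loop hε (0 + (s - a)) n
  have h3 := hb.translate (0 + (s - a) - n * (ε ^ 2 * (4 - Real.pi)))
  simp only [add_sub_cancel, zero_add] at h1 h2 h3
  exact h1.trans (h2.trans (h3.trans (origin_raise hε (by linarith))))

theorem all (hε : 0 < ε) (p q : ℝ × ℝ × ℝ) : OscReach ε p q := by
  obtain ⟨a, ha⟩ := exists_to_origin hε p.1 p.2.1 p.2.2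
  obtain ⟨b, hb⟩ := exists_from_origin hε q.1 q.2.1 q.2.2
  exact ha.trans ((origin_fiber hε a b).trans hb)

end OscReach

theorem mulVec_two (A : Matrix (Fin 2) (Fin 2) ℝ) (v : V2) :
    A.mulVec v = ![A 0 0 * v 0 + A 0 1 * v 1, A 1 0 * v 0 + A 1 1 * v 1] := by
  ext i
  fin_cases i <;> simp [Matrix.mulVec, dotProduct, Fin.sum_univ_two]

/-- Linear change of coordinates from the oscillator `oscFlow` to the Heisenberg system; `k` is
the frequency `√(det A)`. -/
def heisChart (A : Matrix (Fin 2) (Fin 2) ℝ) (η ζ : V2) (k : ℝ) (p : ℝ × ℝ × ℝ) : V2 × ℝ :=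
  let c := omega2 (A.mulVec ζ) ζ
  let v : V2 := c⁻¹ • ((k * p.2.1) • ζ + p.1 • A.mulVec ζ)
  (v, k * p.2.2 / (2 * c) - omega2 (A.mulVec v) (theta η) / k ^ 2)

section Chart

variable {A : Matrix (Fin 2) (Fin 2) ℝ} {η ζ : V2} {α k : ℝ}

theorem mulVec_mulVec_of_trace_zero (htr : A.trace = 0) (hk : k ^ 2 = A.det) (v : V2) :
    A.mulVec (A.mulVec v) = (-k ^ 2) • v := by
  rw [Matrix.trace_fin_two] at htr
  rw [Matrix.det_fin_two] at hk
  have h : A 1 1 = -A 0 0 := by linarith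
  rw [h] at hk
  ext i
  fin_cases i <;> simp [h, hk] <;> ring

theorem heisChart_surjective (htr : A.trace = 0) (hk0 : k ≠ 0)
    (hLARC : omega2 (A.mulVec ζ) ζ ≠ 0) : Function.Surjective (heisChart A η ζ k) := by
  rintro ⟨v, z⟩
  have hv : (omega2 (A.mulVec ζ) ζ)⁻¹ • ((k * (omega2 (A.mulVec v) ζ / k)) • ζ +
      omega2 v ζ • A.mulVec ζ) = v := by
    rw [Matrix.trace_fin_two] at htr
    have h : A 1 1 = -A 0 0 := by linarith
    rw [inv_smul_eq_iff₀ hLARC, mul_div_cancel₀ _ hk0]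
    ext i
    fin_cases i <;> simp [omega2, h] <;> ring
  refine ⟨(omega2 v ζ, omega2 (A.mulVec v) ζ / k,
    2 * omega2 (A.mulVec ζ) ζ * (z + omega2 (A.mulVec v) (theta η) / k ^ 2) / k), ?_⟩
  simp only [heisChart, hv, Prod.mk.injEq, true_and]
  field_simp
  ring

theorem heisChart_vectorField (htr : A.trace = 0) (hk : k ^ 2 = A.det) (hk0 : k ≠ 0)
    (hLARC : omega2 (A.mulVec ζ) ζ ≠ 0)
    (hadrank : α * A.det + omega2 (A.mulVec ζ) (theta η) = 0) (w x y s : ℝ) :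
    heisChart A η ζ k (k * y, -k * (x - w), k * (w * x)) =
      heisF A η ζ α (k ^ 2 * w / omega2 (A.mulVec ζ) ζ) (heisChart A η ζ k (x, y, s)) := by
  have hAA := mulVec_mulVec_of_trace_zero htr hk ζ
  have hα : α = -omega2 (A.mulVec ζ) (theta η) / k ^ 2 := by
    rw [← hk] at hadrank
    field_simp
    linarith
  generalize hξ : A.mulVec ζ = ξ at *
  simp only [heisChart, heisF, htr, hα, hξ, Matrix.mulVec_smul, Matrix.mulVec_add, hAA,
    Prod.mk.injEq]
  constructor
  · ext i
    simp only [Pi.smul_apply, Pi.add_apply, smul_eq_mul]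
    field_simp
    ring
  · have hx : ∀ a b d : ℝ, omega2 (d • (a • ζ + b • ξ)) ζ = d * b * omega2 ξ ζ := by
      intro a b d
      simp [omega2]
      ring
    have hadd : ∀ p q r : V2, omega2 p (q + r) = omega2 p q + omega2 p r := by
      intro p q r
      simp [omega2]
      ring
    have hsmul : ∀ (a : ℝ) (p q : V2), omega2 p (a • q) = a * omega2 p q := by
      intro a p q
      simp [omega2]
      ring
    have hleft : ∀ (a b d : ℝ) (p q r : V2),
        omega2 (d • (a • p + b • q)) r = d * (a * omega2 p r + b * omega2 q r) := by
      intro a b d p q r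
      simp [omega2]
      ring
    simp only [hadd, hsmul, hx, hleft, smul_smul]
    field_simp
    ring

theorem hasDerivAt_oscFlow (w : ℝ) (p : ℝ × ℝ × ℝ) (t : ℝ) :
    HasDerivAt (fun t => oscFlow w (k * t) p)
      (k * (oscFlow w (k * t) p).2.1, -k * ((oscFlow w (k * t) p).1 - w),
        k * (w * (oscFlow w (k * t) p).1)) t := by
  have ht : HasDerivAt (fun t : ℝ => k * t) k t := by simpa using (hasDerivAt_id t).const_mul k
  have hc := ht.cos
  have hs := ht.sin
  refine HasDerivAt.prodMk ?_ (HasDerivAt.prodMk ?_ ?_)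
  · refine (((hc.const_mul (p.1 - w)).const_add w).add (hs.const_mul p.2.1)).congr_deriv ?_
    simp only [oscFlow]
    ring
  · refine ((hc.const_mul p.2.1).sub (hs.const_mul (p.1 - w))).congr_deriv ?_
    simp only [oscFlow]
    ring
  · refine (((((ht.const_mul w).add (hs.const_mul (p.1 - w))).add
      ((hc.const_sub 1).const_mul p.2.1)).const_mul w).const_add p.2.2).congr_deriv ?_
    simp only [oscFlow]
    ring

theorem HasDerivAt.heisChart {g : ℝ → ℝ × ℝ × ℝ} {g' : ℝ × ℝ × ℝ} {t : ℝ}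
    (hg : HasDerivAt g g' t) :
    HasDerivAt (fun t => heisChart A η ζ k (g t)) (heisChart A η ζ k g') t := by
  let L : ℝ × ℝ × ℝ →ₗ[ℝ] V2 × ℝ :=
    { toFun := _root_.heisChart A η ζ k
      map_add' := fun p q => by
        simp only [_root_.heisChart, Prod.mk_add_mk, Prod.mk.injEq, Prod.fst_add, Prod.snd_add]
        constructor
        · module
        · simp only [mulVec_two, omega2, theta, Pi.smul_apply, Pi.add_apply, smul_eq_mul,
            Matrix.cons_val_zero, Matrix.cons_val_one]
          ring
      map_smul' := fun a p => by
        simp only [_root_.heisChart, Prod.smul_mk, Prod.mk.injEq, Prod.smul_fst, Prod.smul_snd,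
          RingHom.id_apply]
        constructor
        · simp only [smul_eq_mul]
          module
        · simp only [mulVec_two, omega2, theta, Pi.smul_apply, Pi.add_apply, smul_eq_mul,
            Matrix.cons_val_zero, Matrix.cons_val_one]
          ring }
  exact (LinearMap.toContinuousLinearMap L).hasFDerivAt.comp_hasDerivAt t hg

theorem hasDerivAt_heisChart_oscFlow (htr : A.trace = 0) (hk : k ^ 2 = A.det) (hk0 : k ≠ 0)
    (hLARC : omega2 (A.mulVec ζ) ζ ≠ 0)
    (hadrank : α * A.det + omega2 (A.mulVec ζ) (theta η) = 0) (w : ℝ) (p : ℝ × ℝ × ℝ) (t : ℝ) :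
    HasDerivAt (fun t => heisChart A η ζ k (oscFlow w (k * t) p))
      (heisF A η ζ α (k ^ 2 * w / omega2 (A.mulVec ζ) ζ)
        (heisChart A η ζ k (oscFlow w (k * t) p))) t := by
  have h := (hasDerivAt_oscFlow (k := k) w p t).heisChart (A := A) (η := η) (ζ := ζ) (k := k)
  rwa [heisChart_vectorField htr hk hk0 hLARC hadrank w _ _ (oscFlow w (k * t) p).2.2] at h

theorem heis_controllable {u₁ u₂ : ℝ} (h₁ : u₁ < 0) (h₂ : 0 < u₂)
    (hdet : 0 < A.det) (htr : A.trace = 0) (hLARC : omega2 (A.mulVec ζ) ζ ≠ 0)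
    (hadrank : α * A.det + omega2 (A.mulVec ζ) (theta η) = 0) (p q : V2 × ℝ) :
    q ∈ PosOrbit (heisF A η ζ α) (Icc u₁ u₂) p := by
  obtain ⟨k, hk0, hk⟩ : ∃ k : ℝ, 0 < k ∧ k ^ 2 = A.det :=
    ⟨_, Real.sqrt_pos.2 hdet, Real.sq_sqrt hdet.le⟩
  obtain ⟨p, rfl⟩ := heisChart_surjective (η := η) htr hk0.ne' hLARC p
  obtain ⟨q, rfl⟩ := heisChart_surjective (η := η) htr hk0.ne' hLARC q
  have hderiv := hasDerivAt_heisChart_oscFlow htr hk hk0.ne' hLARC hadrank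
  set c := omega2 (A.mulVec ζ) ζ
  have hc : 0 < |c| := abs_pos.2 hLARC
  set ε := min (-u₁) u₂ * |c| / k ^ 2
  have hε : 0 < ε := by
    have : 0 < min (-u₁) u₂ := lt_min (by linarith) h₂
    positivity
  have hmem : ∀ w, |w| ≤ ε → k ^ 2 * w / c ∈ Icc u₁ u₂ := by
    intro w hw
    have h : |k ^ 2 * w / c| ≤ min (-u₁) u₂ := by
      rw [abs_div, abs_mul, abs_of_pos (by positivity : 0 < k ^ 2), div_le_iff₀ hc]
      rw [le_div_iff₀ (by positivity)] at hw
      linarith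
    obtain ⟨h3, h4⟩ := abs_le.1 h
    exact ⟨by linarith [min_le_left (-u₁) u₂], by linarith [min_le_right (-u₁) u₂]⟩
  have hzero : ∀ w r, oscFlow w (k * 0) r = r := by
    intro w r
    simp [oscFlow]
  have hr := OscReach.all hε p q
  induction hr using Relation.ReflTransGen.head_induction_on with
  | refl =>
    have := PosOrbit.self_mem (hmem 0 (by simpa using hε.le)) (hderiv 0 q)
    rwa [hzero] at this
  | head hstep _ ih =>
    obtain ⟨w, τ, hw, hτ, rfl⟩ := hstep
    have := PosOrbit.of_constant_step (r := τ / k) (hmem w hw) (by positivity) (hderiv w _)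
      (by rwa [mul_div_cancel₀ _ hk0.ne'])
    rwa [hzero] at this

theorem PosOrbit.fst_of_heis {Ω : Set ℝ} {p q : V2 × ℝ}
    (h : q ∈ PosOrbit (heisF A η ζ α) Ω p) : q.1 ∈ PosOrbit (planF A ζ) Ω p.1 := by
  obtain ⟨u, x, T, hu, hx, rfl, hT, rfl⟩ := h
  refine ⟨u, fun t => (x t).1, T, hu, ⟨hx.1.fst, fun t ht => ?_⟩, rfl, hT, rfl⟩
  exact (ContinuousLinearMap.fst ℝ V2 ℝ).hasFDerivAt.comp_hasDerivWithinAt t (hx.2 t ht)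

end Chart

/-- if `det A > 0`, `tr A = 0` (pure imaginary eigenvalues), the LARC
`ω(Aζ,ζ) ≠ 0` holds and the ad-rank condition fails
(`α·det A + ω(Aζ,θη) = 0`), and `C₂` is a control set of the planar system
`v̇ = Av + uζ` with `0 ∈ int C₂`, then the cylinder `C₂ × ℝ` is the only control
set of `Σ_ℍ`. -/
theorem stmt3 (A : Matrix (Fin 2) (Fin 2) ℝ) (η ζ : V2) (α u₁ u₂ : ℝ)
    (h₁ : u₁ < 0) (h₂ : 0 < u₂)
    (hdet : 0 < A.det) (htr : A.trace = 0)
    (hLARC : omega2 (A.mulVec ζ) ζ ≠ 0)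
    (hadrank : α * A.det + omega2 (A.mulVec ζ) (theta η) = 0)
    (C₂ : Set V2) (hC₂ : IsControlSet (planF A ζ) (Icc u₁ u₂) C₂)
    (h0 : (0 : V2) ∈ interior C₂) :
    IsControlSet (heisF A η ζ α) (Icc u₁ u₂) (C₂ ×ˢ (univ : Set ℝ)) ∧
    ∀ C : Set (V2 × ℝ), IsControlSet (heisF A η ζ α) (Icc u₁ u₂) C →
      C = C₂ ×ˢ (univ : Set ℝ) := by
  have hheis := heis_controllable h₁ h₂ hdet htr hLARC hadrank
  have hplan : ∀ v w : V2, w ∈ PosOrbit (planF A ζ) (Icc u₁ u₂) v :=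
    fun v w => PosOrbit.fst_of_heis (hheis (v, 0) (w, 0))
  obtain rfl : C₂ = univ := hC₂.eq_univ (controlSetProp_univ hplan)
  rw [univ_prod_univ]
  have huniv := controlSetProp_univ hheis
  exact ⟨⟨huniv, fun _ _ h => (univ_subset_iff.1 h).symm⟩, fun C hC => hC.eq_univ huniv⟩
end
end

section
/- Assume det A ≠ 0, tr A = 0, η = 0 (so Σ_ℍ reads v̇ = Av + uζ, ż = uα + (u/2)ω(v,ζ)), ω(Aζ, ζ) ≠ 0, and α ≠ 0. Then for all z₁, z₂ ∈ ℝ there exist T > 0 and an admissible control u with φ(T,(0,z₁),u) = (0,z₂); in particular, for z₁ < z₂ there is a positive-time periodic trajectory of Σ_ℍ passing through both (0,z₁) and (0,z₂). -/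
open Set Matrix

noncomputable section

/-- The data `C, S, E, F` of a fundamental system of `ÿ = -d y`: `C` and `S` are the generalized
cosine and sine, and `E`, `F` are the successive primitives of `S`. -/
structure IsTrigSystem (d : ℝ) (C S E F : ℝ → ℝ) : Prop where
  hasDerivAt_C : ∀ t, HasDerivAt C (-d * S t) t
  hasDerivAt_S : ∀ t, HasDerivAt S (C t) t
  hasDerivAt_E : ∀ t, HasDerivAt E (S t) t
  hasDerivAt_F : ∀ t, HasDerivAt F (E t) t
  C_zero : C 0 = 1
  S_zero : S 0 = 0
  E_zero : E 0 = 0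
  F_zero : F 0 = 0
  C_eq : ∀ t, C t = 1 - d * E t
  sq_add_sq : ∀ t, C t ^ 2 + d * S t ^ 2 = 1

lemma IsTrigSystem.of_C_S {d : ℝ} (hd : d ≠ 0) {C S : ℝ → ℝ}
    (hC : ∀ t, HasDerivAt C (-d * S t) t) (hS : ∀ t, HasDerivAt S (C t) t)
    (hC0 : C 0 = 1) (hS0 : S 0 = 0) (hsq : ∀ t, C t ^ 2 + d * S t ^ 2 = 1) :
    IsTrigSystem d C S (fun t => (1 - C t) / d) (fun t => (t - S t) / d) where
  hasDerivAt_C := hC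
  hasDerivAt_S := hS
  hasDerivAt_E t := by
    refine (((hC t).const_sub 1).div_const d).congr_deriv ?_
    field_simp
  hasDerivAt_F t := ((hasDerivAt_id t).sub (hS t)).div_const d
  C_zero := hC0
  S_zero := hS0
  E_zero := by simp [hC0]
  F_zero := by simp [hS0]
  C_eq t := by field_simp; ring
  sq_add_sq := hsq

lemma exists_isTrigSystem {d : ℝ} (hd : d ≠ 0) :
    ∃ C S E F : ℝ → ℝ, IsTrigSystem d C S E F ∧ ∃ h > 0, C h ≠ 1 := by
  rcases hd.lt_or_gt with hneg | hpos
  · obtain ⟨m, hm, rfl⟩ : ∃ m : ℝ, 0 < m ∧ d = -m ^ 2 :=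
      ⟨√(-d), Real.sqrt_pos.2 (by linarith), by rw [Real.sq_sqrt (by linarith)]; ring⟩
    have hlin (t : ℝ) : HasDerivAt (fun t => m * t) m t := by
      simpa using (hasDerivAt_id t).const_mul m
    refine ⟨fun t => Real.cosh (m * t), fun t => Real.sinh (m * t) / m, _, _,
      .of_C_S hd (fun t => ?_) (fun t => ?_) (by simp) (by simp) (fun t => ?_), 1, one_pos, ?_⟩
    · refine (hlin t).cosh.congr_deriv ?_
      field_simp
    · refine ((hlin t).sinh.div_const m).congr_deriv ?_
      field_simp
    · have := Real.cosh_sq (m * t)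
      field_simp
      linarith
    · exact (Real.one_lt_cosh.2 (by simpa using hm.ne')).ne'
  · obtain ⟨m, hm, rfl⟩ : ∃ m : ℝ, 0 < m ∧ d = m ^ 2 :=
      ⟨√d, Real.sqrt_pos.2 hpos, (Real.sq_sqrt hpos.le).symm⟩
    have hlin (t : ℝ) : HasDerivAt (fun t => m * t) m t := by
      simpa using (hasDerivAt_id t).const_mul m
    refine ⟨fun t => Real.cos (m * t), fun t => Real.sin (m * t) / m, _, _,
      .of_C_S hd (fun t => ?_) (fun t => ?_) (by simp) (by simp) (fun t => ?_),
      Real.pi / m, div_pos Real.pi_pos hm, ?_⟩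
    · refine (hlin t).cos.congr_deriv ?_
      field_simp
    · refine ((hlin t).sin.div_const m).congr_deriv ?_
      field_simp
    · have := Real.sin_sq_add_cos_sq (m * t)
      field_simp
      linarith
    · simp only [mul_div_cancel₀ _ hm.ne', Real.cos_pi]
      norm_num

/-- The solution at time `t` of `Σ_ℍ` (with `tr A = 0`, `η = 0`) started at `p`, for the constant
control `u`, written in terms of a fundamental system of `ÿ = -(det A) y`. -/
def heisFlow (C S E F : ℝ → ℝ) (A : Matrix (Fin 2) (Fin 2) ℝ) (ζ : V2) (α u : ℝ)
    (p : V2 × ℝ) (t : ℝ) : V2 × ℝ :=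
  (C t • p.1 + S t • A.mulVec p.1 + u • (S t • ζ + E t • A.mulVec ζ),
    p.2 + u * α * t + u / 2 * omega2
      (S t • p.1 + E t • A.mulVec p.1 + u • (E t • ζ + F t • A.mulVec ζ)) ζ)

section heisFlow

variable {C S E F : ℝ → ℝ} {A : Matrix (Fin 2) (Fin 2) ℝ} {ζ : V2} {α : ℝ}

lemma heisFlow_zero (H : IsTrigSystem A.det C S E F) (u : ℝ) (p : V2 × ℝ) :
    heisFlow C S E F A ζ α u p 0 = p := by
  simp [heisFlow, H.C_zero, H.S_zero, H.E_zero, H.F_zero, omega2]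

lemma mulVec_mulVec_of_trace_eq_zero (htr : A.trace = 0) (v : V2) :
    A.mulVec (A.mulVec v) = -A.det • v := by
  have h11 : A 1 1 = -A 0 0 := by
    rw [Matrix.trace_fin_two] at htr
    linarith
  ext i
  fin_cases i <;> simp [Matrix.mulVec, dotProduct, Matrix.det_fin_two, h11] <;> ring

lemma hasDerivAt_heisFlow (H : IsTrigSystem A.det C S E F) (htr : A.trace = 0) (u : ℝ)
    (p : V2 × ℝ) (t : ℝ) :
    HasDerivAt (heisFlow C S E F A ζ α u p)
      (heisF A 0 ζ α u (heisFlow C S E F A ζ α u p t)) t := by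
  have hC := H.hasDerivAt_C t
  have hS := H.hasDerivAt_S t
  have hE := H.hasDerivAt_E t
  have hF := H.hasDerivAt_F t
  refine HasDerivAt.prodMk ?_ ?_
  · refine (((hC.smul_const p.1).add (hS.smul_const (A.mulVec p.1))).add
      (((hS.smul_const ζ).add (hE.smul_const (A.mulVec ζ))).const_smul u)).congr_deriv ?_
    simp only [heisFlow, Matrix.mulVec_add, Matrix.mulVec_smul,
      mulVec_mulVec_of_trace_eq_zero htr]
    rw [H.C_eq t]
    module
  · have hI (i : Fin 2) : HasDerivAt (fun t => (S t • p.1 + E t • A.mulVec p.1 +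
        u • (E t • ζ + F t • A.mulVec ζ)) i)
        ((C t • p.1 + S t • A.mulVec p.1 + u • (S t • ζ + E t • A.mulVec ζ)) i) t :=
      ((hS.mul_const (p.1 i)).add (hE.mul_const (A.mulVec p.1 i))).add
        (((hE.mul_const (ζ i)).add (hF.mul_const (A.mulVec ζ i))).const_mul u)
    have hω := ((hI 0).mul_const (ζ 1)).sub ((hI 1).mul_const (ζ 0))
    refine ((((hasDerivAt_id t).const_mul (u * α)).const_add p.2).add
      (hω.const_mul (u / 2))).congr_deriv ?_
    simp [heisFlow, htr, omega2, theta]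
    ring

/-- Three steps with controls `s, -2 C(h) s, s` bring the plane component back to the origin. -/
lemma heisFlow_loop (H : IsTrigSystem A.det C S E F) (htr : A.trace = 0) (h : ℝ) :
    ∃ Q : ℝ, ∀ s z : ℝ,
      heisFlow C S E F A ζ α s (heisFlow C S E F A ζ α (-2 * C h * s)
        (heisFlow C S E F A ζ α s (0, z) h) h) h =
      (0, z + (2 * (1 - C h) * α * h * s + Q * s ^ 2)) := by
  have hsq := H.sq_add_sq h
  set b : V2 := S h • ζ + E h • A.mulVec ζ with hb
  set J : V2 := E h • ζ + F h • A.mulVec ζ with hJ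
  set v : V2 := C h • b + S h • A.mulVec b + (-2 * C h) • b with hv
  refine ⟨1 / 2 * omega2 J ζ
    - C h * omega2 (S h • b + E h • A.mulVec b + (-2 * C h) • J) ζ
    + 1 / 2 * omega2 (S h • v + E h • A.mulVec v + J) ζ, fun s z => ?_⟩
  have step (w z : ℝ) (y : V2) : heisFlow C S E F A ζ α (w * s) (s • y, z) h =
      (s • (C h • y + S h • A.mulVec y + w • b), z + w * s * α * h +
        w / 2 * s ^ 2 * omega2 (S h • y + E h • A.mulVec y + w • J) ζ) := by
    simp only [heisFlow, Matrix.mulVec_smul, ← hb, ← hJ, Prod.mk.injEq]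
    constructor
    · module
    · simp only [omega2, Pi.add_apply, Pi.smul_apply, smul_eq_mul]
      ring
  have e1 := step 1 z 0
  simp only [one_mul, smul_zero, Matrix.mulVec_zero, zero_add, one_smul] at e1
  have e2 := step (-2 * C h)
    (z + s * α * h + 1 / 2 * s ^ 2 * omega2 J ζ) b
  rw [e1, e2, ← hv]
  have e3 := step 1 (z + s * α * h + 1 / 2 * s ^ 2 * omega2 J ζ + -2 * C h * s * α * h +
    -2 * C h / 2 * s ^ 2 * omega2 (S h • b + E h • A.mulVec b + (-2 * C h) • J) ζ) v
  simp only [one_mul, one_smul] at e3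
  rw [e3]
  have hloop : C h • v + S h • A.mulVec v + b = 0 := by
    have : C h • v + S h • A.mulVec v + b = (1 - (C h ^ 2 + A.det * S h ^ 2)) • b := by
      simp only [hv, Matrix.mulVec_add, Matrix.mulVec_smul, mulVec_mulVec_of_trace_eq_zero htr]
      module
    rw [this, hsq, sub_self, zero_smul]
  rw [hloop, smul_zero, Prod.mk.injEq]
  exact ⟨rfl, by ring⟩

end heisFlow

lemma natFloor_div_eq_iff {h : ℝ} (hh : 0 < h) (k : ℕ) {t : ℝ} (ht : 0 ≤ t) :
    ⌊t / h⌋₊ = k ↔ k * h ≤ t ∧ t < (k + 1) * h := by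
  rw [Nat.floor_eq_iff (by positivity), le_div_iff₀ hh, div_lt_iff₀ hh]

lemma piecewiseConst_natFloor_div {h : ℝ} (hh : 0 < h) (g : ℕ → ℝ) :
    PiecewiseConst fun t => g ⌊t / h⌋₊ := by
  intro T _
  refine ⟨⌈T / h⌉₊, fun i => i * h, by simp, fun i j hij => ?_, ?_, fun i _ s hs => ?_⟩
  · exact mul_lt_mul_of_pos_right (by exact_mod_cast hij) hh
  · exact (div_le_iff₀ hh).1 (Nat.le_ceil _)
  · have hi : (0 : ℝ) ≤ i * h := by positivity
    have h1 : ⌊s / h⌋₊ = i :=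
      (natFloor_div_eq_iff hh i (hi.trans hs.1)).2 ⟨hs.1, by simpa using hs.2⟩
    simp only [h1, mul_div_cancel_right₀ _ hh.ne', Nat.floor_natCast]

/-- Gluing flow lines for constant controls over successive intervals of length `h`. -/
lemma exists_isTraj_of_flow {M : Type*} [NormedAddCommGroup M] [NormedSpace ℝ M]
    {f : ℝ → M → M} {flow : ℝ → M → ℝ → M} (flow_zero : ∀ u p, flow u p 0 = p)
    (hasDerivAt_flow : ∀ u p t, HasDerivAt (flow u p) (f u (flow u p t)) t)
    {h : ℝ} (hh : 0 < h) {g : ℕ → ℝ} {X : ℕ → M} (hX : ∀ k, X (k + 1) = flow (g k) (X k) h) :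
    ∃ x : ℝ → M, IsTraj f (fun t => g ⌊t / h⌋₊) x ∧ ∀ k : ℕ, x (k * h) = X k := by
  set x : ℝ → M := fun t => flow (g ⌊t / h⌋₊) (X ⌊t / h⌋₊) (t - ⌊t / h⌋₊ * h) with hx
  have x_grid (k : ℕ) : x (k * h) = X k := by
    simp [hx, mul_div_cancel_right₀ _ hh.ne', flow_zero]
  have x_eq (k : ℕ) {t : ℝ} (ht : t ∈ Icc (k * h) ((k + 1) * h)) :
      x t = flow (g k) (X k) (t - k * h) := by
    rcases ht.2.lt_or_eq with hlt | rfl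
    · have hk : (0 : ℝ) ≤ k * h := by positivity
      simp only [hx, (natFloor_div_eq_iff hh k (hk.trans ht.1)).2 ⟨ht.1, hlt⟩]
    · have := x_grid (k + 1)
      push_cast at this
      rw [this, hX]
      congr 1
      ring
  have shifted (k : ℕ) (t : ℝ) : HasDerivAt (fun s => flow (g k) (X k) (s - k * h))
      (f (g k) (flow (g k) (X k) (t - k * h))) t :=
    (hasDerivAt_flow (g k) (X k) (t - k * h)).comp_sub_const t (k * h)
  have right_deriv (t : ℝ) (ht : 0 ≤ t) :
      HasDerivWithinAt x (f (g ⌊t / h⌋₊) (x t)) (Ici t) t := by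
    obtain ⟨h1, h2⟩ := (natFloor_div_eq_iff hh ⌊t / h⌋₊ ht).1 rfl
    refine (shifted ⌊t / h⌋₊ t).hasDerivWithinAt.congr_of_eventuallyEq ?_ rfl
    filter_upwards [Ico_mem_nhdsGE h2] with s hs
    exact x_eq _ ⟨h1.trans hs.1, hs.2.le⟩
  refine ⟨x, ⟨fun t ht => ?_, right_deriv⟩, x_grid⟩
  rcases (mem_Ici.1 ht).eq_or_lt with rfl | hpos
  · exact (right_deriv 0 le_rfl).continuousWithinAt
  · refine (continuousAt_iff_continuous_left_right.2
      ⟨?_, (right_deriv t ht).continuousWithinAt⟩).continuousWithinAt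
    obtain ⟨k, hk⟩ : ∃ k, ⌈t / h⌉₊ = k + 1 :=
      Nat.exists_eq_succ_of_ne_zero (Nat.ceil_pos.2 (div_pos hpos hh)).ne'
    rw [Nat.ceil_eq_iff (by simp)] at hk
    obtain ⟨h1, h2⟩ := hk
    rw [Nat.add_sub_cancel, lt_div_iff₀ hh] at h1
    rw [div_le_iff₀ hh] at h2
    push_cast at h2
    refine (shifted k t).continuousAt.continuousWithinAt.congr_of_eventuallyEq ?_
      (x_eq k ⟨h1.le, h2⟩)
    filter_upwards [Ioc_mem_nhdsLE h1] with s hs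
    exact x_eq k ⟨hs.1.le, hs.2.trans h2⟩

/-- The values `a s + Q s²`, for `s` in a neighborhood of `0`, contain `±δ / N` for large `N`. -/
lemma exists_nat_mul_quadratic_eq {a : ℝ} (ha : a ≠ 0) (Q : ℝ) {U : Set ℝ}
    (hU : U ∈ nhds (0 : ℝ)) (δ : ℝ) :
    ∃ N : ℕ, 0 < N ∧ (∃ s ∈ U, N * (a * s + Q * s ^ 2) = δ) ∧
      ∃ s ∈ U, N * (a * s + Q * s ^ 2) = -δ := by
  have hderiv : HasStrictDerivAt (fun s : ℝ => a * s + Q * s ^ 2) a 0 := by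
    refine (((hasStrictDerivAt_id (0 : ℝ)).const_mul a).add
      (((hasStrictDerivAt_id (0 : ℝ)).pow 2).const_mul Q)).congr_deriv ?_
    simp
  have himage : (fun s : ℝ => a * s + Q * s ^ 2) '' U ∈ nhds (0 : ℝ) := by
    have := Filter.image_mem_map (m := fun s : ℝ => a * s + Q * s ^ 2) hU
    rw [hderiv.map_nhds_eq ha] at this
    simpa using this
  have lim (c : ℝ) : Filter.Tendsto (fun N : ℕ => c / (N : ℝ)) Filter.atTop (nhds 0) :=
    tendsto_const_div_atTop_nhds_zero_nat c
  obtain ⟨N, ⟨⟨s, hs, e⟩, s', hs', e'⟩, hN⟩ :=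
    (((lim δ).eventually himage).and ((lim (-δ)).eventually himage)).and
      (Filter.eventually_gt_atTop 0) |>.exists
  have hN' : (N : ℝ) ≠ 0 := by exact_mod_cast hN.ne'
  dsimp only at e e'
  exact ⟨N, hN, ⟨s, hs, by rw [e]; field_simp⟩, s', hs', by rw [e']; field_simp⟩

/-- Over the fiber `{0} × ℝ` one can follow loops of a common period `P`, the `j`-th one being
driven by an arbitrary small parameter `s j` and raising the height by `a s + Q s²`. -/
lemma exists_isTraj_loops (A : Matrix (Fin 2) (Fin 2) ℝ) (ζ : V2) {α u₁ u₂ : ℝ}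
    (h₁ : u₁ < 0) (h₂ : 0 < u₂) (hdet : A.det ≠ 0) (htr : A.trace = 0) (hα : α ≠ 0) :
    ∃ P > 0, ∃ a Q : ℝ, a ≠ 0 ∧ ∃ U ∈ nhds (0 : ℝ), ∀ (s : ℕ → ℝ) (z : ℝ), (∀ j, s j ∈ U) →
      ∃ (u : ℝ → ℝ) (x : ℝ → V2 × ℝ), Admissible (Icc u₁ u₂) u ∧
        IsTraj (heisF A 0 ζ α) u x ∧ ∀ j : ℕ, x (j * P) =
          ((0 : V2), z + ∑ i ∈ Finset.range j, (a * s i + Q * s i ^ 2)) := by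
  obtain ⟨C, S, E, F, H, h, hh, hC⟩ := exists_isTrigSystem hdet
  obtain ⟨Q, hQ⟩ := heisFlow_loop (ζ := ζ) (α := α) H htr h
  have hIcc : Icc u₁ u₂ ∈ nhds (0 : ℝ) := Icc_mem_nhds h₁ h₂
  have hIcc' : (fun s => -2 * C h * s) ⁻¹' Icc u₁ u₂ ∈ nhds (0 : ℝ) :=
    (continuous_const_mul (-2 * C h)).continuousAt.preimage_mem_nhds (by simpa using hIcc)
  refine ⟨3 * h, by positivity, 2 * (1 - C h) * α * h, Q,
    mul_ne_zero (mul_ne_zero (mul_ne_zero two_ne_zero (sub_ne_zero.2 hC.symm)) hα) hh.ne',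
    _, Filter.inter_mem hIcc hIcc', fun s z hs => ?_⟩
  set g : ℕ → ℝ := fun k => if k % 3 = 1 then -2 * C h * s (k / 3) else s (k / 3) with hg
  let X : ℕ → V2 × ℝ :=
    Nat.rec (0, z) fun k p => heisFlow C S E F A ζ α (g k) p h
  have hX (k : ℕ) : X (k + 1) = heisFlow C S E F A ζ α (g k) (X k) h := rfl
  obtain ⟨x, hx, hgrid⟩ := exists_isTraj_of_flow (heisFlow_zero H)
    (hasDerivAt_heisFlow H htr) hh hX
  refine ⟨_, x, ⟨fun t => ?_, piecewiseConst_natFloor_div hh g⟩, hx, fun j => ?_⟩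
  · simp only [hg]
    split_ifs
    exacts [(hs _).2, (hs _).1]
  · have hloops : X (3 * j) =
        ((0 : V2), z + ∑ i ∈ Finset.range j, (2 * (1 - C h) * α * h * s i + Q * s i ^ 2)) := by
      induction j with
      | zero => simp [X]
      | succ j ih =>
        have g0 : g (3 * j) = s j := by
          simp [hg]
        have g1 : g (3 * j + 1) = -2 * C h * s j := by
          simp only [hg]
          rw [if_pos (by omega), show (3 * j + 1) / 3 = j by omega]
        have g2 : g (3 * j + 2) = s j := by
          simp only [hg]
          rw [if_neg (by omega), show (3 * j + 2) / 3 = j by omega]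
        rw [show 3 * (j + 1) = 3 * j + 2 + 1 by ring, hX, hX, hX, g0, g1, g2, ih, hQ,
          Finset.sum_range_succ, add_assoc]
    rw [← hloops, ← hgrid]
    push_cast
    congr 1
    ring

/-- assume `det A ≠ 0`, `tr A = 0`, `η = 0`, the LARC `ω(Aζ,ζ) ≠ 0`,
and `α ≠ 0`. Then any two points of the fiber `{0} × ℝ` can be joined by a
positive-time trajectory of `Σ_ℍ`; in particular, for `z₁ < z₂` there is a
positive-time periodic trajectory passing through both `(0,z₁)` and `(0,z₂)`. -/
theorem stmt9 (A : Matrix (Fin 2) (Fin 2) ℝ) (ζ : V2) (α u₁ u₂ : ℝ)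
    (h₁ : u₁ < 0) (h₂ : 0 < u₂)
    (hdet : A.det ≠ 0) (htr : A.trace = 0)
    (hLARC : omega2 (A.mulVec ζ) ζ ≠ 0) (hα : α ≠ 0) :
    (∀ z₁ z₂ : ℝ, ∃ (T : ℝ) (u : ℝ → ℝ) (x : ℝ → V2 × ℝ), 0 < T ∧
      Admissible (Icc u₁ u₂) u ∧ IsTraj (heisF A 0 ζ α) u x ∧
      x 0 = (((0 : V2), z₁) : V2 × ℝ) ∧ x T = (((0 : V2), z₂) : V2 × ℝ)) ∧
    (∀ z₁ z₂ : ℝ, z₁ < z₂ → ∃ (T : ℝ) (u : ℝ → ℝ) (x : ℝ → V2 × ℝ), 0 < T ∧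
      Admissible (Icc u₁ u₂) u ∧ IsTraj (heisF A 0 ζ α) u x ∧
      x T = x 0 ∧
      (∃ t₁ ∈ Icc (0 : ℝ) T, x t₁ = (((0 : V2), z₁) : V2 × ℝ)) ∧
      (∃ t₂ ∈ Icc (0 : ℝ) T, x t₂ = (((0 : V2), z₂) : V2 × ℝ))) := by
  obtain ⟨P, hP, a, Q, ha, U, hU, hloops⟩ := exists_isTraj_loops A ζ h₁ h₂ hdet htr hα
  refine ⟨fun z₁ z₂ => ?_, fun z₁ z₂ _ => ?_⟩
  · obtain ⟨N, hN, ⟨s, hs, e⟩, -⟩ := exists_nat_mul_quadratic_eq ha Q hU (z₂ - z₁)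
    obtain ⟨u, x, hu, hx, hgrid⟩ := hloops (fun _ => s) z₁ fun _ => hs
    refine ⟨N * P, u, x, by positivity, hu, hx, by simpa using hgrid 0, ?_⟩
    rw [hgrid, Finset.sum_const, Finset.card_range, nsmul_eq_mul, e, add_sub_cancel]
  · obtain ⟨N, hN, ⟨s, hs, e⟩, s', hs', e'⟩ := exists_nat_mul_quadratic_eq ha Q hU (z₂ - z₁)
    obtain ⟨u, x, hu, hx, hgrid⟩ := hloops (fun i => if i < N then s else s') z₁ fun i => by
      split_ifs
      exacts [hs, hs']
    have hx0 : x 0 = (0, z₁) := by simpa using hgrid 0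
    have hsum : ∑ i ∈ Finset.range N, (a * (if i < N then s else s') +
        Q * (if i < N then s else s') ^ 2) = z₂ - z₁ := by
      rw [Finset.sum_congr rfl fun i hi => by rw [if_pos (Finset.mem_range.1 hi)],
        Finset.sum_const, Finset.card_range, nsmul_eq_mul, e]
    have hxN : x (N * P) = (0, z₂) := by
      rw [hgrid, hsum, add_sub_cancel]
    refine ⟨(N + N : ℕ) * P, u, x, by positivity, hu, hx, ?_,
      ⟨0, ⟨le_rfl, by positivity⟩, hx0⟩, ⟨N * P, ⟨by positivity, ?_⟩, hxN⟩⟩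
    · rw [hx0, hgrid, Finset.sum_range_add, hsum]
      simp only [not_lt.2 (Nat.le_add_right N _), if_false, Finset.sum_const, Finset.card_range,
        nsmul_eq_mul, e']
      simp
    · gcongr
      exact Nat.le_add_left N N
end
end
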